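/- arXiv:2507.14973 — 2 statements merged into one kernel-verified Lean document; each statement's English description precedes it below -/
import Mathlib

section
/- Assume the principle (*): there is no tree π-base for ω* of height less than 𝔠, and every tree π-base for ω* of height 𝔠 has a cofinal branch. Then for every sequentially compact topological space X of cardinality at most 𝔠 and every index type ι, the power X^ι with the product topology is countably compact. -/
/-- `y` is a `p`-limit of the sequence `x`: every open neighbourhood of `y`
contains `x n` for a `p`-large set of `n`. -/
def IsPLimit {X : Type*} [TopologicalSpace X] (p : Ultrafilter ℕ) (x : ℕ → X) (y : X) : Prop :=
  ∀ U : Set X, IsOpen U → y ∈ U → {n | x n ∈ U} ∈ p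

/-- `X` is `p`-compact: every sequence in `X` has a `p`-limit. -/
def PCompact (X : Type*) [TopologicalSpace X] (p : Ultrafilter ℕ) : Prop :=
  ∀ x : ℕ → X, ∃ y : X, IsPLimit p x y

/-- An ultrafilter on `ℕ` is nonprincipal if it contains no finite set. -/
def Nonprincipal (p : Ultrafilter ℕ) : Prop :=
  ∀ A : Set ℕ, A.Finite → A ∉ p

/-- `a ⊆* b`: `a \ b` is finite. -/
def AlmostSubset (a b : Set ℕ) : Prop := (a \ b).Finite

/-- `f : ℕ → ℕ` is finite-to-one: every fiber is finite. -/
def FiniteToOne (f : ℕ → ℕ) : Prop := ∀ n : ℕ, (f ⁻¹' {n}).Finite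

/-- A topological space is countably compact if every countable open cover
has a finite subcover. -/
def CountablyCompact (X : Type*) [TopologicalSpace X] : Prop :=
  ∀ 𝒰 : Set (Set X), 𝒰.Countable → (∀ U ∈ 𝒰, IsOpen U) → ⋃₀ 𝒰 = Set.univ →
    ∃ 𝒱 : Set (Set X), 𝒱 ⊆ 𝒰 ∧ 𝒱.Finite ∧ ⋃₀ 𝒱 = Set.univ

/-- The strict tree order on a tree π-base: `s < t` iff `t ⊆* s` but not `s ⊆* t`. -/
def TreeLT (s t : Set ℕ) : Prop := AlmostSubset t s ∧ ¬ AlmostSubset s t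

/-- The set of strict predecessors of `t` inside `T`. -/
def predSet (T : Set (Set ℕ)) (t : Set ℕ) : Set (Set ℕ) := {s ∈ T | TreeLT s t}

/-- The strict order restricted to the predecessors of `t` in `T`. -/
def predRel (T : Set (Set ℕ)) (t : Set ℕ) : predSet T t → predSet T t → Prop :=
  fun a b => TreeLT a.1 b.1

/-- The set of strict predecessors of `t` in `T` is well-ordered with order type `ξ`. -/
def HasPredOrderType (T : Set (Set ℕ)) (t : Set ℕ) (ξ : Ordinal) : Prop :=
  ∃ h : IsWellOrder (predSet T t) (predRel T t), @Ordinal.type _ (predRel T t) h = ξ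

/-- The `ξ`-th level of `T`: elements whose set of strict predecessors has order type `ξ`. -/
def TreeLevel (T : Set (Set ℕ)) (ξ : Ordinal) : Set (Set ℕ) :=
  {t ∈ T | HasPredOrderType T t ξ}

/-- A maximal almost disjoint family of infinite subsets of `ℕ`. -/
def IsMadFamily (A : Set (Set ℕ)) : Prop :=
  (∀ a ∈ A, a.Infinite) ∧
  (∀ a ∈ A, ∀ b ∈ A, a ≠ b → (a ∩ b).Finite) ∧
  (∀ x : Set ℕ, x.Infinite → ∃ a ∈ A, (x ∩ a).Infinite)

/-- `T` is a tree π-base for `ω*`. -/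
structure IsTreePiBase (T : Set (Set ℕ)) : Prop where
  /-- members are infinite subsets of `ℕ` -/
  infinite_mem : ∀ t ∈ T, t.Infinite
  /-- `T` is a tree: the strict predecessors of each element are well-ordered -/
  tree : ∀ t ∈ T, IsWellOrder (predSet T t) (predRel T t)
  /-- each nonempty level is an infinite maximal almost disjoint family -/
  levels : ∀ ξ : Ordinal, (TreeLevel T ξ).Nonempty →
    (TreeLevel T ξ).Infinite ∧ IsMadFamily (TreeLevel T ξ)
  /-- `T` is a π-base: every infinite `A ⊆ ℕ` almost contains a member of `T` -/
  pibase : ∀ A : Set ℕ, A.Infinite → ∃ t ∈ T, AlmostSubset t A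

/-- `ξ` is the height of `T`: the least ordinal whose level is empty. -/
def IsHeight (T : Set (Set ℕ)) (ξ : Ordinal) : Prop :=
  TreeLevel T ξ = ∅ ∧ ∀ η : Ordinal, η < ξ → (TreeLevel T η).Nonempty

/-- A cofinal branch of `T`: a maximal chain (in the order `s ≤ t ↔ t ⊆* s`)
meeting every nonempty level. -/
def IsCofinalBranch (T b : Set (Set ℕ)) : Prop :=
  b ⊆ T ∧ IsChain (fun s t => AlmostSubset t s) b ∧
  (∀ c : Set (Set ℕ), c ⊆ T → IsChain (fun s t => AlmostSubset t s) c → b ⊆ c → b = c) ∧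
  ∀ ξ : Ordinal, (TreeLevel T ξ).Nonempty → (b ∩ TreeLevel T ξ).Nonempty

/-- The principle `(*)`: there is no tree π-base for `ω*` of height `< 𝔠`, and
every tree π-base of height `𝔠` has a cofinal branch. -/
def StarPrinciple : Prop :=
  (∀ T : Set (Set ℕ), ∀ ξ : Ordinal, IsTreePiBase T → IsHeight T ξ →
      ¬ ξ < Cardinal.continuum.ord) ∧
  (∀ T : Set (Set ℕ), IsTreePiBase T → IsHeight T Cardinal.continuum.ord →
      ∃ b : Set (Set ℕ), IsCofinalBranch T b)

open Set Cardinal Filter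

namespace AlmostSubset

theorem of_subset {a b : Set ℕ} (h : a ⊆ b) : AlmostSubset a b := by
  simp [AlmostSubset, sdiff_eq_empty.2 h]

theorem refl (a : Set ℕ) : AlmostSubset a a := of_subset Subset.rfl

theorem trans {a b c : Set ℕ} (hab : AlmostSubset a b) (hbc : AlmostSubset b c) :
    AlmostSubset a c := by
  refine (hab.union hbc).subset fun n hn => ?_
  by_cases hb : n ∈ b
  · exact Or.inr ⟨hb, hn.2⟩
  · exact Or.inl ⟨hn.1, hb⟩

theorem inter {a b c : Set ℕ} (hb : AlmostSubset a b) (hc : AlmostSubset a c) :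
    AlmostSubset a (b ∩ c) := by
  refine (hb.union hc).subset fun n hn => ?_
  by_cases h : n ∈ b
  · exact Or.inr ⟨hn.1, fun hc => hn.2 ⟨h, hc⟩⟩
  · exact Or.inl ⟨hn.1, h⟩

theorem infinite {a b : Set ℕ} (h : AlmostSubset a b) (ha : a.Infinite) : b.Infinite := fun hb =>
  ha ((h.union hb).subset fun n hn => by
    by_cases hnb : n ∈ b
    · exact Or.inr hnb
    · exact Or.inl ⟨hn, hnb⟩)

theorem inter_left {a b : Set ℕ} (h : AlmostSubset a b) (c : Set ℕ) :
    AlmostSubset (a ∩ c) (b ∩ c) :=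
  ((of_subset inter_subset_left).trans h).inter (of_subset inter_subset_right)

theorem infinite_inter {a b c : Set ℕ} (h : AlmostSubset a b) (ha : (a ∩ c).Infinite) :
    (b ∩ c).Infinite := (h.inter_left c).infinite ha

theorem infinite_inter_self {a b : Set ℕ} (h : AlmostSubset a b) (ha : a.Infinite) :
    (a ∩ b).Infinite := ((refl a).inter h).infinite ha

end AlmostSubset

theorem Set.Infinite.exists_orderEmbedding_range_eq {Y : Set ℕ} (hY : Y.Infinite) :
    ∃ e : ℕ ↪o ℕ, range e = Y := by
  classical
  have := hY.to_subtype
  exact ⟨Nat.orderEmbeddingOfSet Y, Nat.orderEmbeddingOfSet_range Y⟩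

theorem Set.Infinite.exists_split {Y : Set ℕ} (hY : Y.Infinite) :
    ∃ Z ⊆ Y, Z.Infinite ∧ (Y \ Z).Infinite := by
  obtain ⟨e, he⟩ := hY.exists_orderEmbedding_range_eq
  refine ⟨range fun n => e (2 * n), ?_, ?_, ?_⟩
  · rintro _ ⟨n, rfl⟩
    exact he ▸ mem_range_self _
  · exact infinite_range_of_injective fun m n h => by
      have := e.injective h
      omega
  · refine (infinite_range_of_injective (f := fun n => e (2 * n + 1)) fun m n h => by
      have := e.injective h
      omega).mono ?_
    rintro _ ⟨n, rfl⟩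
    refine ⟨he ▸ mem_range_self _, ?_⟩
    rintro ⟨m, hm⟩
    have := e.injective hm
    omega

theorem exists_infinite_almostSubset_of_antitone {W : ℕ → Set ℕ} (hW : Antitone W)
    (hinf : ∀ n, (W n).Infinite) : ∃ P : Set ℕ, P.Infinite ∧ ∀ n, AlmostSubset P (W n) := by
  obtain ⟨φ, hφ, hmem⟩ := extraction_forall_of_frequently (P := fun n k => k ∈ W n)
    fun n => Nat.frequently_atTop_iff_infinite.2 (hinf n)
  refine ⟨range φ, infinite_range_of_injective hφ.injective, fun n => ?_⟩
  refine ((finite_lt_nat n).image φ).subset ?_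
  rintro _ ⟨⟨m, rfl⟩, hm⟩
  exact ⟨m, not_le.1 fun h => hm (hW h (hmem m)), rfl⟩

/-- A family of infinite sets which is open and dense in the order `⊆*`. -/
structure OpenDense (D : Set (Set ℕ)) : Prop where
  infinite : ∀ Z ∈ D, Z.Infinite
  down : ∀ Z ∈ D, ∀ Z' : Set ℕ, Z'.Infinite → AlmostSubset Z' Z → Z' ∈ D
  dense : ∀ Y : Set ℕ, Y.Infinite → ∃ Z ∈ D, AlmostSubset Z Y

theorem OpenDense.dense_subset {D : Set (Set ℕ)} (hD : OpenDense D) {Y : Set ℕ}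
    (hY : Y.Infinite) : ∃ Z ∈ D, Z ⊆ Y := by
  obtain ⟨Z, hZ, hZY⟩ := hD.dense Y hY
  exact ⟨Z ∩ Y, hD.down Z hZ _ (hZY.infinite_inter_self (hD.infinite Z hZ))
    (.of_subset inter_subset_left), inter_subset_right⟩

theorem OpenDense.inter {D E : Set (Set ℕ)} (hD : OpenDense D) (hE : OpenDense E) :
    OpenDense (D ∩ E) where
  infinite Z hZ := hD.infinite Z hZ.1
  down Z hZ Z' hi h := ⟨hD.down Z hZ.1 Z' hi h, hE.down Z hZ.2 Z' hi h⟩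
  dense Y hY := by
    obtain ⟨Z, hZ, hZY⟩ := hD.dense Y hY
    obtain ⟨Z', hZ', h⟩ := hE.dense Z (hD.infinite Z hZ)
    exact ⟨Z', ⟨hD.down Z hZ _ (hE.infinite _ hZ') h, hZ'⟩, h.trans hZY⟩

theorem OpenDense.exists_forall_mem {D : ℕ → Set (Set ℕ)} (hD : ∀ n, OpenDense (D n)) :
    ∃ Z, ∀ n, Z ∈ D n := by
  have step : ∀ n (Y : {Y : Set ℕ // Y.Infinite}), ∃ Z : {Y : Set ℕ // Y.Infinite},
      Z.1 ∈ D n ∧ Z.1 ⊆ Y.1 := fun n Y => by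
    obtain ⟨Z, hZ, h⟩ := (hD n).dense_subset Y.2
    exact ⟨⟨Z, (hD n).infinite Z hZ⟩, hZ, h⟩
  choose f hf hsub using step
  let W : ℕ → {Y : Set ℕ // Y.Infinite} := fun n => Nat.rec ⟨univ, infinite_univ⟩ f n
  obtain ⟨P, hP, h⟩ := exists_infinite_almostSubset_of_antitone (W := fun n => (W n).1)
    (antitone_nat_of_succ_le fun n => hsub n (W n)) fun n => (W n).2
  exact ⟨P, fun n => (hD n).down _ (hf n (W n)) P hP (h (n + 1))⟩

theorem OpenDense.exists_isMadFamily {D : Set (Set ℕ)} (hD : OpenDense D) :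
    ∃ A ⊆ D, IsMadFamily A := by
  obtain ⟨A, hA⟩ := zorn_subset
    {A : Set (Set ℕ) | A ⊆ D ∧ A.Pairwise fun a b => (a ∩ b).Finite} (by
    intro c hc hchain
    refine ⟨⋃₀ c, ⟨sUnion_subset fun s hs => (hc hs).1, ?_⟩, fun s hs => subset_sUnion_of_mem hs⟩
    exact (pairwise_sUnion hchain.directedOn).2 fun s hs => (hc hs).2)
  refine ⟨A, hA.prop.1, fun a ha => hD.infinite a (hA.prop.1 ha),
    fun a ha b hb hab => hA.prop.2 ha hb hab, fun x hx => ?_⟩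
  by_contra! hcon
  obtain ⟨Z, hZ, hZx⟩ := hD.dense_subset hx
  have hfin : ∀ a ∈ A, (Z ∩ a).Finite := fun a ha =>
    (hcon a ha).subset (inter_subset_inter_left _ hZx)
  have hins : insert Z A ⊆ A := hA.le_of_ge
    ⟨insert_subset hZ hA.prop.1, hA.prop.2.insert fun b hb _ =>
      ⟨hfin b hb, inter_comm Z b ▸ hfin b hb⟩⟩ (subset_insert _ _)
  exact hD.infinite Z hZ (by simpa using hfin Z (hins (mem_insert _ _)))

namespace IsMadFamily

variable {A : Set (Set ℕ)}

theorem eq_of_infinite (hA : IsMadFamily A) {a b : Set ℕ} (ha : a ∈ A) (hb : b ∈ A)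
    (h : (a ∩ b).Infinite) : a = b := by
  by_contra hne
  exact h (hA.2.1 a ha b hb hne)

theorem eq_of_almostSubset (hA : IsMadFamily A) {a b t : Set ℕ} (ha : a ∈ A) (hb : b ∈ A)
    (ht : t.Infinite) (hta : AlmostSubset t a) (htb : AlmostSubset t b) : a = b :=
  hA.eq_of_infinite ha hb ((hta.inter htb).infinite ht)

theorem nonempty (hA : IsMadFamily A) : A.Nonempty :=
  let ⟨a, ha, _⟩ := hA.2.2 univ infinite_univ
  ⟨a, ha⟩

theorem infinite_of_notMem_ultrafilter (hA : IsMadFamily A) {u : Ultrafilter ℕ}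
    (hu : (u : Filter ℕ) ≤ cofinite) (h : ∀ a ∈ A, a ∉ u) : A.Infinite := by
  intro hfin
  have h1 : (⋃₀ A)ᶜ.Finite := by
    by_contra hinf
    obtain ⟨a, ha, hi⟩ := hA.2.2 _ hinf
    exact hi (finite_empty.subset fun n hn => hn.1 ⟨a, ha, hn.2⟩)
  have h2 : ⋃₀ A ∈ u := hu (mem_cofinite.2 h1)
  obtain ⟨a, ha, hau⟩ := (Ultrafilter.finite_sUnion_mem_iff hfin).1 h2
  exact h a ha hau

end IsMadFamily

theorem openDense_notMem_ultrafilter {u : Ultrafilter ℕ} (hu : (u : Filter ℕ) ≤ cofinite) :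
    OpenDense {Z : Set ℕ | Z.Infinite ∧ Z ∉ u} where
  infinite Z hZ := hZ.1
  down := by
    rintro Z ⟨-, hZ⟩ W hW hWZ
    refine ⟨hW, fun hWu => hZ ?_⟩
    have hc : (W \ Z)ᶜ ∈ u := hu (mem_cofinite.2 (by rwa [compl_compl]))
    filter_upwards [hWu, hc] with n hn hn'
    exact not_not.1 fun h => hn' ⟨hn, h⟩
  dense Y hY := by
    obtain ⟨Z, hZY, hZ, hZ'⟩ := hY.exists_split
    by_cases h : Z ∈ u
    · refine ⟨Y \ Z, ⟨hZ', fun h' => ?_⟩, .of_subset sdiff_subset⟩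
      exact u.empty_notMem (mem_of_superset (inter_mem h h') fun n hn => hn.2.2 hn.1)
    · exact ⟨Z, ⟨hZ, h⟩, .of_subset hZY⟩

theorem openDense_almostSubset_or_finite_inter (Y : Set ℕ) :
    OpenDense {Z : Set ℕ | Z.Infinite ∧ (AlmostSubset Z Y ∨ (Z ∩ Y).Finite)} where
  infinite Z hZ := hZ.1
  down := by
    rintro Z ⟨-, h⟩ W hW hWZ
    refine ⟨hW, h.imp hWZ.trans fun hf => ?_⟩
    by_contra hi
    exact hWZ.infinite_inter hi hf
  dense Z hZ := by
    by_cases h : (Z ∩ Y).Finite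
    · exact ⟨Z, ⟨hZ, .inr h⟩, .refl _⟩
    · exact ⟨Z ∩ Y, ⟨h, .inl (.of_subset inter_subset_right)⟩, .of_subset inter_subset_left⟩

/-- The infinite sets lying strictly below a member `a` of `A` and deciding `g a`. -/
def refiningSets (A : Set (Set ℕ)) (g : Set ℕ → Set ℕ) : Set (Set ℕ) :=
  {Z | Z.Infinite ∧ ∃ a ∈ A, AlmostSubset Z a ∧ ¬ AlmostSubset a Z ∧
    (AlmostSubset Z (g a) ∨ (Z ∩ g a).Finite)}

theorem openDense_refiningSets {A : Set (Set ℕ)} (hA : IsMadFamily A) (g : Set ℕ → Set ℕ) :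
    OpenDense (refiningSets A g) where
  infinite Z hZ := hZ.1
  down := by
    rintro Z ⟨hZ, a, ha, h1, h2, h3⟩ W hW hWZ
    exact ⟨hW, a, ha, hWZ.trans h1, fun h => h2 (h.trans hWZ),
      ((openDense_almostSubset_or_finite_inter (g a)).down Z ⟨hZ, h3⟩ W hW hWZ).2⟩
  dense Y hY := by
    obtain ⟨a, ha, hYa⟩ := hA.2.2 Y hY
    obtain ⟨Z, hZ, hZY⟩ := (openDense_almostSubset_or_finite_inter (g a)).dense_subset hYa
    obtain ⟨W, hWZ, hW, hZW⟩ := hZ.1.exists_split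
    have hW' := (openDense_almostSubset_or_finite_inter (g a)).down Z hZ W hW (.of_subset hWZ)
    refine ⟨W, ⟨hW, a, ha, .of_subset fun n hn => (hZY (hWZ hn)).2, fun h => ?_, hW'.2⟩,
      .of_subset fun n hn => (hZY (hWZ hn)).1⟩
    exact hZW (h.subset fun n hn => ⟨(hZY hn.1).2, hn.2⟩)

/-- Any `κ` many open dense families have a dense intersection. -/
def IsDistributive (κ : Ordinal.{0}) : Prop :=
  ∀ D : Ordinal.{0} → Set (Set ℕ), (∀ β < κ, OpenDense (D β)) →
    ∀ Y : Set ℕ, Y.Infinite → ∃ Z : Set ℕ, Z.Infinite ∧ AlmostSubset Z Y ∧ ∀ β < κ, Z ∈ D β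

theorem IsDistributive.openDense {κ : Ordinal.{0}} (hκ : IsDistributive κ)
    {D : Ordinal.{0} → Set (Set ℕ)} (hD : ∀ β < κ, OpenDense (D β)) :
    OpenDense {Z | Z.Infinite ∧ ∀ β < κ, Z ∈ D β} where
  infinite Z hZ := hZ.1
  down Z hZ W hW h := ⟨hW, fun β hβ => (hD β hβ).down Z (hZ.2 β hβ) W hW h⟩
  dense Y hY := by
    obtain ⟨Z, h1, h2, h3⟩ := hκ D hD Y hY
    exact ⟨Z, ⟨h1, h3⟩, h2⟩

/-- A sequence of MAD families of length `κ`, each strictly refining the earlier ones, with the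
`α`-th family inside `D α` and deciding all sets coded by `g` at the earlier families. -/
structure IsRefiningMatrix (κ : Ordinal.{0}) (g : Set (Set ℕ) → Set ℕ → Set ℕ)
    (D A : Ordinal.{0} → Set (Set ℕ)) : Prop where
  mad : ∀ α < κ, IsMadFamily (A α)
  subset : ∀ α < κ, A α ⊆ D α
  refining : ∀ α < κ, ∀ β < α, A α ⊆ refiningSets (A β) (g (A β))

theorem exists_isRefiningMatrix {κ : Ordinal.{0}} (hκ : ∀ α < κ, IsDistributive α)
    (g : Set (Set ℕ) → Set ℕ → Set ℕ) {D : Ordinal.{0} → Set (Set ℕ)}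
    (hD : ∀ α < κ, OpenDense (D α)) : ∃ A, IsRefiningMatrix κ g D A := by
  classical
  let F : (α : Ordinal.{0}) → ((β : Ordinal.{0}) → β < α → Set (Set ℕ)) → Set (Set ℕ) :=
    fun α prev => if h : ∃ A : Set (Set ℕ), IsMadFamily A ∧ A ⊆ D α ∧
      ∀ β (hβ : β < α), A ⊆ refiningSets (prev β hβ) (g (prev β hβ)) then h.choose else ∅
  let A : Ordinal.{0} → Set (Set ℕ) := WellFounded.fix Ordinal.lt_wf F
  have hA : ∀ α, A α = F α fun β _ => A β := WellFounded.fix_eq Ordinal.lt_wf F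
  have key : ∀ α < κ, IsMadFamily (A α) ∧ A α ⊆ D α ∧
      ∀ β < α, A α ⊆ refiningSets (A β) (g (A β)) := by
    intro α
    induction α using WellFoundedLT.induction with
    | ind α ih =>
      intro hα
      have hod := (hD α hα).inter ((hκ α hα).openDense fun β hβ =>
        openDense_refiningSets (ih β hβ (hβ.trans hα)).1 (g (A β)))
      obtain ⟨B, hB, hmad⟩ := hod.exists_isMadFamily
      have hex : ∃ A' : Set (Set ℕ), IsMadFamily A' ∧ A' ⊆ D α ∧
          ∀ β, β < α → A' ⊆ refiningSets (A β) (g (A β)) :=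
        ⟨B, hmad, fun Z hZ => (hB hZ).1, fun β hβ Z hZ => (hB hZ).2.2 β hβ⟩
      have hAα : A α = hex.choose := by rw [hA α]; exact dif_pos hex
      rw [hAα]
      exact hex.choose_spec
  exact ⟨A, fun α h => (key α h).1, fun α h => (key α h).2.1, fun α h => (key α h).2.2⟩

namespace IsRefiningMatrix

variable {κ : Ordinal.{0}} {g : Set (Set ℕ) → Set ℕ → Set ℕ} {D A : Ordinal.{0} → Set (Set ℕ)}

/-- The union of the families of a matrix. -/
def carrier (κ : Ordinal.{0}) (A : Ordinal.{0} → Set (Set ℕ)) : Set (Set ℕ) :=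
  {t | ∃ α < κ, t ∈ A α}

theorem exists_almostSubset (h : IsRefiningMatrix κ g D A) {α β : Ordinal.{0}} (hα : α < κ)
    (hβ : β ≤ α) {t : Set ℕ} (ht : t ∈ A α) : ∃ s ∈ A β, AlmostSubset t s := by
  rcases hβ.eq_or_lt with rfl | hβ
  · exact ⟨t, ht, .refl t⟩
  · obtain ⟨-, a, ha, hta, -⟩ := h.refining α hα β hβ ht
    exact ⟨a, ha, hta⟩

theorem treeLT_of_infinite_inter (h : IsRefiningMatrix κ g D A) {α β : Ordinal.{0}} (hα : α < κ)
    (hβ : β < α) {s t : Set ℕ} (ht : t ∈ A α) (hs : s ∈ A β) (hst : (t ∩ s).Infinite) :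
    TreeLT s t := by
  obtain ⟨-, a, ha, hta, hat, -⟩ := h.refining α hα β hβ ht
  obtain rfl := (h.mad β (hβ.trans hα)).eq_of_infinite ha hs (hta.infinite_inter hst)
  exact ⟨hta, hat⟩

theorem lt_of_treeLT (h : IsRefiningMatrix κ g D A) {α β : Ordinal.{0}} (hα : α < κ)
    (hβ : β < κ) {s t : Set ℕ} (ht : t ∈ A α) (hs : s ∈ A β) (hst : TreeLT s t) : β < α := by
  have hinf : (s ∩ t).Infinite := by
    rw [inter_comm]
    exact hst.1.infinite_inter_self ((h.mad α hα).1 t ht)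
  rcases lt_trichotomy β α with hlt | rfl | hlt
  · exact hlt
  · obtain rfl := (h.mad β hβ).eq_of_infinite hs ht hinf
    exact absurd (.refl _) hst.2
  · exact absurd (h.treeLT_of_infinite_inter hβ hlt hs ht hinf).1 hst.2

theorem hasPredOrderType (h : IsRefiningMatrix κ g D A) {α : Ordinal.{0}} (hα : α < κ)
    {t : Set ℕ} (ht : t ∈ A α) : HasPredOrderType (carrier κ A) t α := by
  have hti := (h.mad α hα).1 t ht
  have hex : ∀ b : α.ToType, ∃ s ∈ A (Ordinal.ToType.mk.symm b).1, AlmostSubset t s := fun b =>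
    h.exists_almostSubset hα (Ordinal.ToType.mk.symm b).2.le ht
  choose f hfA hft using hex
  have hlt : ∀ b : α.ToType, (Ordinal.ToType.mk.symm b).1 < α := fun b =>
    (Ordinal.ToType.mk.symm b).2
  have hmem : ∀ b, f b ∈ predSet (carrier κ A) t := fun b =>
    ⟨⟨_, (hlt b).trans hα, hfA b⟩, h.treeLT_of_infinite_inter hα (hlt b) ht (hfA b)
      ((hft b).infinite_inter_self hti)⟩
  have hmono : ∀ b c : α.ToType, b < c → TreeLT (f b) (f c) := fun b c hbc =>
    h.treeLT_of_infinite_inter ((hlt c).trans hα)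
      (Subtype.coe_lt_coe.2 (Ordinal.ToType.mk.symm.lt_iff_lt.2 hbc)) (hfA c) (hfA b)
      (((hft c).inter (hft b)).infinite hti)
  have hrel : ∀ b c : α.ToType, TreeLT (f b) (f c) ↔ b < c := by
    refine fun b c => ⟨fun hbc => ?_, hmono b c⟩
    by_contra hcb
    rcases (not_lt.1 hcb).eq_or_lt with rfl | hcb
    · exact hbc.2 hbc.1
    · exact hbc.2 (hmono c b hcb).1
  let F : α.ToType → predSet (carrier κ A) t := fun b => ⟨f b, hmem b⟩
  have hinj : Function.Injective F := fun b c hbc => by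
    have hbc : f b = f c := congrArg Subtype.val hbc
    rcases lt_trichotomy b c with hl | hl | hl
    · exact absurd (.of_subset hbc.le) (hmono b c hl).2
    · exact hl
    · exact absurd (.of_subset hbc.ge) (hmono c b hl).2
  have hsurj : Function.Surjective F := by
    rintro ⟨s, ⟨β, hβ, hs⟩, hst⟩
    have hβα := h.lt_of_treeLT hα hβ ht hs hst
    refine ⟨Ordinal.ToType.mk ⟨β, hβα⟩, Subtype.ext ?_⟩
    have hfs := hfA (Ordinal.ToType.mk ⟨β, hβα⟩)
    rw [OrderIso.symm_apply_apply] at hfs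
    exact (h.mad β hβ).eq_of_almostSubset hfs hs hti (hft _) hst.1
  let e : (· < · : α.ToType → α.ToType → Prop) ≃r predRel (carrier κ A) t :=
    ⟨Equiv.ofBijective F ⟨hinj, hsurj⟩, fun {b c} => hrel b c⟩
  have hwo : IsWellOrder _ (predRel (carrier κ A) t) := e.symm.toRelEmbedding.isWellOrder
  refine ⟨hwo, ?_⟩
  rw [← Ordinal.type_toType α]
  exact Ordinal.type_eq.2 ⟨e.symm⟩

theorem treeLevel_eq (h : IsRefiningMatrix κ g D A) (ξ : Ordinal.{0}) :
    TreeLevel (carrier κ A) ξ = {t | ξ < κ ∧ t ∈ A ξ} := by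
  ext t
  constructor
  · rintro ⟨⟨α, hα, ht⟩, hw, rfl⟩
    obtain ⟨_, h2⟩ := h.hasPredOrderType hα ht
    exact h2.symm ▸ ⟨hα, ht⟩
  · rintro ⟨hξ, ht⟩
    exact ⟨⟨ξ, hξ, ht⟩, h.hasPredOrderType hξ ht⟩

theorem isHeight (h : IsRefiningMatrix κ g D A) : IsHeight (carrier κ A) κ := by
  refine ⟨by simp [h.treeLevel_eq], fun η hη => ?_⟩
  obtain ⟨a, ha⟩ := (h.mad η hη).nonempty
  exact ⟨a, by rw [h.treeLevel_eq]; exact ⟨hη, ha⟩⟩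

theorem isTreePiBase (h : IsRefiningMatrix κ g D A) (hinf : ∀ α < κ, (A α).Infinite)
    (hbase : ∀ Y : Set ℕ, Y.Infinite → ∃ t ∈ carrier κ A, AlmostSubset t Y) :
    IsTreePiBase (carrier κ A) where
  infinite_mem := by
    rintro t ⟨α, hα, ht⟩
    exact (h.mad α hα).1 t ht
  tree := by
    rintro t ⟨α, hα, ht⟩
    exact (h.hasPredOrderType hα ht).1
  levels ξ := by
    rintro ⟨t, ht⟩
    rw [h.treeLevel_eq] at ht ⊢
    simpa [ht.1] using ⟨hinf ξ ht.1, h.mad ξ ht.1⟩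
  pibase := hbase

end IsRefiningMatrix

/-- A family of at most `c` many sets, each of size at least `c`, has a system of distinct
representatives. -/
theorem Cardinal.exists_injective_forall_mem {S β : Type} {c : Cardinal.{0}} (hS : #S ≤ c)
    (F : S → Set β) (hF : ∀ s, c ≤ #(F s)) : ∃ f : S → β, f.Injective ∧ ∀ s, f s ∈ F s := by
  classical
  obtain ⟨r, hwo, hr⟩ := Cardinal.exists_ord_eq S
  have hne : ∀ (s : S) (prev : (s' : S) → r s' s → β),
      ∃ b ∈ F s, ∀ s' (h : r s' s), prev s' h ≠ b := by
    intro s prev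
    by_contra! hcon
    have hsub : F s ⊆ range fun p : {s' // r s' s} => prev p.1 p.2 := fun b hb => by
      obtain ⟨s', h, hb⟩ := hcon b hb
      exact ⟨⟨s', h⟩, hb⟩
    have hlt : #{s' // r s' s} < #S := by
      have := Cardinal.card_typein_lt s hr
      rwa [Ordinal.card_typein] at this
    exact absurd ((hF s).trans ((mk_le_mk_of_subset hsub).trans mk_range_le))
      (not_le.2 (hlt.trans_le hS))
  choose G hGF hGne using hne
  have wf : WellFounded r := hwo.wf
  have hfix : ∀ s, wf.fix G s = G s fun s' _ => wf.fix G s' := wf.fix_eq G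
  have hlt : ∀ s s', r s' s → wf.fix G s' ≠ wf.fix G s := fun s s' h => by
    rw [hfix s]
    exact hGne s (fun s' _ => wf.fix G s') s' h
  refine ⟨wf.fix G, fun s s' h => ?_, fun s => hfix s ▸ hGF s _⟩
  rcases trichotomous_of r s s' with hr | hr | hr
  · exact absurd h (hlt _ _ hr)
  · exact hr
  · exact absurd h.symm (hlt _ _ hr)

theorem exists_coding_of_continuum_le (A : Set (Set ℕ)) : ∃ g : Set ℕ → Set ℕ,
    ∀ Y, 𝔠 ≤ #{a | a ∈ A ∧ (a ∩ Y).Infinite} → ∃ a ∈ A, (a ∩ Y).Infinite ∧ g a = Y := by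
  let S := {Y : Set ℕ // 𝔠 ≤ #{a | a ∈ A ∧ (a ∩ Y).Infinite}}
  have hS : #S ≤ 𝔠 := (mk_subtype_le _).trans (by simp)
  obtain ⟨f, hf, hmem⟩ := Cardinal.exists_injective_forall_mem hS
    (fun Y : S => {a | a ∈ A ∧ (a ∩ Y.1).Infinite}) fun Y => Y.2
  refine ⟨Function.extend f Subtype.val fun _ => ∅, fun Y hY => ?_⟩
  exact ⟨f ⟨Y, hY⟩, (hmem ⟨Y, hY⟩).1, (hmem ⟨Y, hY⟩).2, hf.extend_apply _ _ _⟩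

/-- The reversed initial segment of length `n` of a binary sequence. -/
def binaryPrefix (x : ℕ → Bool) : ℕ → List Bool
  | 0 => []
  | n + 1 => x n :: binaryPrefix x n

theorem binaryPrefix_congr {x y : ℕ → Bool} {n : ℕ} (h : ∀ m < n, x m = y m) :
    binaryPrefix x n = binaryPrefix y n := by
  induction n with
  | zero => rfl
  | succ n ih =>
    rw [binaryPrefix, binaryPrefix, h n n.lt_succ_self, ih fun m hm => h m (hm.trans n.lt_succ_self)]

/-- The tree of sets obtained from `Y` by intersecting repeatedly with the two sets `sp W b`. -/
def splittingTree (sp : Set ℕ → Bool → Set ℕ) (Y : Set ℕ) : List Bool → Set ℕ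
  | [] => Y
  | b :: l => splittingTree sp Y l ∩ sp (splittingTree sp Y l) b

namespace IsRefiningMatrix

variable {κ : Ordinal.{0}} {g : Set (Set ℕ) → Set ℕ → Set ℕ} {D A : Ordinal.{0} → Set (Set ℕ)}

theorem exists_continuum_le (h : IsRefiningMatrix κ g D A)
    (hcof : ∀ l : List Bool → Ordinal.{0}, (∀ s, l s < κ) → ∃ γ < κ, ∀ s, l s < γ)
    (hsplit : ∀ Y : Set ℕ, Y.Infinite → ∃ α < κ, ∃ a ∈ A α, ∃ b ∈ A α, a ≠ b ∧
      (Y ∩ a).Infinite ∧ (Y ∩ b).Infinite) {Y : Set ℕ} (hY : Y.Infinite) :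
    ∃ γ < κ, 𝔠 ≤ #{a | a ∈ A γ ∧ (a ∩ Y).Infinite} := by
  have hsplit' : ∀ W : Set ℕ, ∃ (α : Ordinal.{0}) (sp : Bool → Set ℕ), W.Infinite →
      α < κ ∧ (∀ b, sp b ∈ A α ∧ (W ∩ sp b).Infinite) ∧ sp false ≠ sp true := by
    intro W
    by_cases hW : W.Infinite
    · obtain ⟨α, hα, a, ha, b, hb, hab, h1, h2⟩ := hsplit W hW
      refine ⟨α, fun i => cond i b a, fun _ => ⟨hα, fun i => ?_, hab⟩⟩
      cases i
      exacts [⟨ha, h1⟩, ⟨hb, h2⟩]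
    · exact ⟨0, fun _ => ∅, fun h => absurd h hW⟩
  choose lv sp hsp using hsplit'
  let W := splittingTree sp Y
  have hW : ∀ l, (W l).Infinite := fun l => by
    induction l with
    | nil => exact hY
    | cons b l ih => exact ((hsp _ ih).2.1 b).2
  obtain ⟨γ, hγ, hlv⟩ := hcof (fun l => lv (W l)) fun l => (hsp _ (hW l)).1
  refine ⟨γ, hγ, ?_⟩
  have hP : ∀ x : ℕ → Bool, ∃ P : Set ℕ, P.Infinite ∧
      ∀ n, AlmostSubset P (W (binaryPrefix x n)) := fun x =>
    exists_infinite_almostSubset_of_antitone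
      (antitone_nat_of_succ_le fun n => inter_subset_left) fun n => hW _
  choose P hPinf hPsub using hP
  have ha : ∀ x, ∃ a ∈ A γ, (P x ∩ a).Infinite := fun x => (h.mad γ hγ).2.2 _ (hPinf x)
  choose a haA haP using ha
  have haY : ∀ x, (a x ∩ Y).Infinite := fun x => by
    rw [inter_comm]
    exact (hPsub x 0).infinite_inter (haP x)
  have hasub : ∀ x n, AlmostSubset (a x) (sp (W (binaryPrefix x n)) (x n)) := fun x n => by
    have hs := hsp _ (hW (binaryPrefix x n))
    have hsA := (hs.2.1 (x n)).1
    obtain ⟨c, hc, hac⟩ := h.exists_almostSubset hγ (hlv (binaryPrefix x n)).le (haA x)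
    have h1 : (sp (W (binaryPrefix x n)) (x n) ∩ a x).Infinite :=
      ((hPsub x (n + 1)).trans (.of_subset inter_subset_right)).infinite_inter (haP x)
    rw [inter_comm] at h1
    exact (h.mad _ hs.1).eq_of_infinite hc hsA (hac.infinite_inter h1) ▸ hac
  have hinj : Function.Injective a := by
    intro x y hxy
    by_contra hne
    have hex : ∃ n, x n ≠ y n := Function.ne_iff.1 hne
    classical
    have hpre := binaryPrefix_congr (n := Nat.find hex) fun m hm => not_not.1 (Nat.find_min hex hm)
    have hn := Nat.find_spec hex
    have hs := hsp _ (hW (binaryPrefix x (Nat.find hex)))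
    have h1 := hasub x (Nat.find hex)
    have h2 := hasub y (Nat.find hex)
    rw [← hxy, ← hpre] at h2
    have heq := (h.mad _ hs.1).eq_of_almostSubset (hs.2.1 _).1 (hs.2.1 _).1
      ((h.mad γ hγ).1 _ (haA x)) h1 h2
    generalize x (Nat.find hex) = i at heq hn
    generalize y (Nat.find hex) = j at heq hn
    cases i <;> cases j
    exacts [hn rfl, hs.2.2 heq, hs.2.2 heq.symm, hn rfl]
  have := mk_le_of_injective (f := fun x => (⟨a x, haA x, haY x⟩ :
    {a | a ∈ A γ ∧ (a ∩ Y).Infinite})) fun x y hxy => hinj (congrArg Subtype.val hxy)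
  rwa [← power_def, mk_bool, mk_nat, two_power_aleph0] at this

end IsRefiningMatrix

theorem OpenDense.preimage_image {D : Set (Set ℕ)} (hD : OpenDense D) {e : ℕ → ℕ}
    (he : e.Injective) : OpenDense {Z | e '' Z ∈ D} where
  infinite Z hZ := (hD.infinite _ hZ).of_image e
  down Z hZ W hW hWZ := hD.down _ hZ _ (hW.image he.injOn) (by
    rw [AlmostSubset, ← image_sdiff he]
    exact hWZ.image e)
  dense Y hY := by
    obtain ⟨W, hW, hWY⟩ := hD.dense_subset (hY.image he.injOn)
    refine ⟨e ⁻¹' W, ?_, .of_subset fun n hn => ?_⟩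
    · rwa [mem_ofPred_eq, image_preimage_eq_of_subset (hWY.trans (image_subset_range _ _))]
    · obtain ⟨m, hm, hmn⟩ := hWY hn
      exact he hmn ▸ hm

theorem StarPrinciple.isDistributive (hstar : StarPrinciple) {κ : Ordinal.{0}}
    (hκ : κ < (𝔠).ord) : IsDistributive κ := by
  induction κ using WellFoundedLT.induction with
  | ind κ ih =>
    have ih : ∀ α < κ, IsDistributive α := fun α hα => ih α hα (hα.trans hκ)
    by_contra hbad
    simp only [IsDistributive, not_forall] at hbad
    obtain ⟨D, hD, X, hX, hDX⟩ := hbad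
    obtain ⟨e, he⟩ := hX.exists_orderEmbedding_range_eq
    let u : Ultrafilter ℕ := hyperfilter ℕ
    let E : Ordinal.{0} → Set (Set ℕ) := fun β =>
      {Z | e '' Z ∈ D β} ∩ {Z | Z.Infinite ∧ Z ∉ u}
    have hE : ∀ β < κ, OpenDense (E β) := fun β hβ =>
      ((hD β hβ).preimage_image e.injective).inter
        (openDense_notMem_ultrafilter hyperfilter_le_cofinite)
    have hEempty : ∀ Z : Set ℕ, Z.Infinite → ∃ β < κ, Z ∉ E β := by
      intro Z hZ
      by_contra! hcon
      exact hDX ⟨e '' Z, hZ.image e.injective.injOn,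
        .of_subset (he ▸ image_subset_range _ _), fun β hβ => (hcon β hβ).1⟩
    have hcof : ∀ l : List Bool → Ordinal.{0}, (∀ s, l s < κ) → ∃ γ < κ, ∀ s, l s < γ := by
      intro l hl
      by_contra! hcon
      obtain ⟨f, hf⟩ := exists_surjective_nat (List Bool)
      obtain ⟨Z, hZ⟩ := OpenDense.exists_forall_mem fun n =>
        ((ih _ (hl (f n))).openDense fun β hβ => hE β (hβ.trans (hl (f n)))).inter
          (hE _ (hl (f n)))
      obtain ⟨β, hβ, hZβ⟩ := hEempty Z (hZ 0).1.1
      obtain ⟨s, hs⟩ := hcon β hβ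
      obtain ⟨n, rfl⟩ := hf s
      rcases hs.eq_or_lt with rfl | hs
      · exact hZβ (hZ n).2
      · exact hZβ ((hZ n).1.2 β hs)
    choose g hg using exists_coding_of_continuum_le
    obtain ⟨A, hA⟩ := exists_isRefiningMatrix ih g hE
    have hsplit : ∀ Y : Set ℕ, Y.Infinite → ∃ α < κ, ∃ a ∈ A α, ∃ b ∈ A α, a ≠ b ∧
        (Y ∩ a).Infinite ∧ (Y ∩ b).Infinite := by
      intro Y hY
      obtain ⟨α, hα, hYα⟩ := hEempty Y hY
      obtain ⟨a, ha, hYa⟩ := (hA.mad α hα).2.2 Y hY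
      have hYa' : (Y \ a).Infinite := fun hfin =>
        hYα ((hE α hα).down a (hA.subset α hα ha) Y hY hfin)
      obtain ⟨b, hb, hYb⟩ := (hA.mad α hα).2.2 _ hYa'
      refine ⟨α, hα, a, ha, b, hb, ?_, hYa, hYb.mono (inter_subset_inter_left _ sdiff_subset)⟩
      rintro rfl
      exact hYb (finite_empty.subset fun n hn => hn.1.2 hn.2)
    refine hstar.1 _ κ (hA.isTreePiBase (fun α hα => ?_) fun Y hY => ?_) hA.isHeight hκ
    · exact (hA.mad α hα).infinite_of_notMem_ultrafilter (u := u) hyperfilter_le_cofinite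
        fun a ha => (hA.subset α hα ha).2.2
    · obtain ⟨γ, hγ, hc⟩ := hA.exists_continuum_le hcof hsplit hY
      obtain ⟨a, ha, haY, hga⟩ := hg (A γ) Y hc
      obtain ⟨δ, hδ, hγδ⟩ := hcof (fun _ => γ) fun _ => hγ
      have hγδ := hγδ []
      obtain ⟨Z, hZ, haZ⟩ := (hA.mad δ hδ).2.2 _ haY
      refine ⟨Z, ⟨δ, hδ, hZ⟩, ?_⟩
      obtain ⟨-, b, hb, hZb, -, hdec⟩ := hA.refining δ hδ γ hγδ hZ
      have hab : b = a := (hA.mad γ hγ).eq_of_infinite hb ha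
        (hZb.infinite_inter (haZ.mono fun n hn => ⟨hn.2, hn.1.1⟩))
      rw [hab, hga] at hdec
      exact hdec.resolve_right (haZ.mono fun n hn => ⟨hn.2, hn.1.2⟩)

theorem Cardinal.exists_injective_lt_ord {S : Type} {c : Cardinal.{0}} (h : #S ≤ c) :
    ∃ f : S → Ordinal.{0}, f.Injective ∧ ∀ s, f s < c.ord := by
  obtain ⟨r, hwo, hr⟩ := Cardinal.exists_ord_eq S
  exact ⟨fun s => Ordinal.typein r s, Ordinal.typein_injective r, fun s =>
    (Ordinal.typein_lt_type r s).trans_le (hr ▸ ord_le_ord.2 h)⟩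

/-- Given an injective code, only the condition with code `α` (if any) is imposed at `α`. -/
theorem OpenDense.setOf_code {S : Type} {f : S → Ordinal.{0}} (hf : f.Injective)
    {E : S → Set (Set ℕ)} (hE : ∀ s, OpenDense (E s)) (α : Ordinal.{0}) :
    OpenDense {Z | Z.Infinite ∧ ∀ s, f s = α → Z ∈ E s} where
  infinite Z hZ := hZ.1
  down Z hZ W hW h := ⟨hW, fun s hs => (hE s).down Z (hZ.2 s hs) W hW h⟩
  dense Y hY := by
    by_cases h : ∃ s, f s = α
    · obtain ⟨s, rfl⟩ := h
      obtain ⟨Z, hZ, hZY⟩ := (hE s).dense Y hY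
      exact ⟨Z, ⟨(hE s).infinite Z hZ, fun t ht => hf ht ▸ hZ⟩, hZY⟩
    · exact ⟨Y, ⟨hY, fun s hs => absurd ⟨s, hs⟩ h⟩, .refl Y⟩

theorem openDense_convergent {X : Type*} [TopologicalSpace X] [SeqCompactSpace X] (x : ℕ → X) :
    OpenDense {Z : Set ℕ | Z.Infinite ∧
      ∃ y, ∀ U, IsOpen U → y ∈ U → AlmostSubset Z {n | x n ∈ U}} where
  infinite Z hZ := hZ.1
  down := by
    rintro Z ⟨-, y, hy⟩ W hW h
    exact ⟨hW, y, fun U hU hyU => h.trans (hy U hU hyU)⟩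
  dense Y hY := by
    obtain ⟨e, rfl⟩ := hY.exists_orderEmbedding_range_eq
    obtain ⟨y, φ, hφ, hy⟩ := SeqCompactSpace.tendsto_subseq (x ∘ e)
    refine ⟨range (e ∘ φ), ⟨infinite_range_of_injective (e.injective.comp hφ.injective),
      y, fun U hU hyU => ?_⟩, .of_subset (range_comp_subset_range _ _)⟩
    have hev : ∀ᶠ n in cofinite, x (e (φ n)) ∈ U :=
      Nat.cofinite_eq_atTop ▸ hy (hU.mem_nhds hyU)
    refine (Set.Finite.image (e ∘ φ) hev).subset ?_
    rintro _ ⟨⟨n, rfl⟩, hn⟩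
    exact ⟨n, hn, rfl⟩

theorem exists_ultrafilter_of_isChain_almostSubset {b : Set (Set ℕ)} (hne : b.Nonempty)
    (hinf : ∀ t ∈ b, t.Infinite) (hb : IsChain (fun s t => AlmostSubset t s) b) :
    ∃ p : Ultrafilter ℕ, ∀ t ∈ b, ∀ S, AlmostSubset t S → S ∈ p := by
  let F : Filter ℕ :=
    { sets := {S | ∃ t ∈ b, AlmostSubset t S}
      univ_sets := ⟨_, hne.some_mem, .of_subset (subset_univ _)⟩
      sets_of_superset := by
        rintro S S' ⟨t, ht, h⟩ hS
        exact ⟨t, ht, h.trans (.of_subset hS)⟩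
      inter_sets := by
        rintro S S' ⟨t, ht, h⟩ ⟨t', ht', h'⟩
        by_cases htt : t = t'
        · exact ⟨t, ht, h.inter (htt ▸ h')⟩
        rcases hb ht ht' htt with hs | hs
        · exact ⟨t', ht', (hs.trans h).inter h'⟩
        · exact ⟨t, ht, h.inter (hs.trans h')⟩ }
  have : F.NeBot := ⟨fun h => by
    obtain ⟨t, ht, h⟩ : ∅ ∈ F := h ▸ mem_bot
    exact h.infinite (hinf t ht) finite_empty⟩
  exact ⟨Ultrafilter.of F, fun t ht S h => Ultrafilter.of_le F ⟨t, ht, h⟩⟩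

theorem StarPrinciple.exists_pCompact (hstar : StarPrinciple) (X : Type) [TopologicalSpace X]
    [SeqCompactSpace X] (hX : #X ≤ 𝔠) : ∃ p : Ultrafilter ℕ, Nonprincipal p ∧ PCompact X p := by
  have hseq : #(ℕ → X) ≤ 𝔠 := by
    rw [← power_def, mk_nat, ← continuum_power_aleph0]
    exact power_le_power_right hX
  obtain ⟨f, hf, hflt⟩ := Cardinal.exists_injective_lt_ord hseq
  obtain ⟨f', hf', hflt'⟩ := Cardinal.exists_injective_lt_ord (S := Set ℕ) (c := 𝔠) (by simp)
  let u : Ultrafilter ℕ := hyperfilter ℕ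
  obtain ⟨A, hA⟩ := exists_isRefiningMatrix (κ := (𝔠).ord)
    (fun α hα => hstar.isDistributive hα) (fun _ => id) fun α _ =>
    (openDense_notMem_ultrafilter (u := u) hyperfilter_le_cofinite).inter
      ((OpenDense.setOf_code hf openDense_convergent α).inter
        (OpenDense.setOf_code hf' openDense_almostSubset_or_finite_inter α))
  have hT := hA.isTreePiBase
    (fun α hα => (hA.mad α hα).infinite_of_notMem_ultrafilter (u := u) hyperfilter_le_cofinite
      fun a ha => (hA.subset α hα ha).1.2) fun Y hY => by
    obtain ⟨Z, hZ, hYZ⟩ := (hA.mad _ (hflt' Y)).2.2 Y hY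
    refine ⟨Z, ⟨_, hflt' Y, hZ⟩, ?_⟩
    exact ((hA.subset _ (hflt' Y) hZ).2.2.2 Y rfl).2.resolve_right (inter_comm Y Z ▸ hYZ)
  obtain ⟨b, hbT, hchain, -, hb⟩ := hstar.2 _ hT hA.isHeight
  have hmeet : ∀ α < (𝔠).ord, ∃ t ∈ b, t ∈ A α := fun α hα => by
    obtain ⟨t, htb, ht⟩ := hb α (hA.isHeight.2 α hα)
    rw [hA.treeLevel_eq] at ht
    exact ⟨t, htb, ht.2⟩
  obtain ⟨t₀, ht₀, -⟩ := hmeet _ (hflt' ∅)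
  obtain ⟨p, hp⟩ := exists_ultrafilter_of_isChain_almostSubset ⟨t₀, ht₀⟩
    (fun t ht => hT.infinite_mem t (hbT ht)) hchain
  refine ⟨p, fun S hS hSp => ?_, fun x => ?_⟩
  · have hc : Sᶜ ∈ p := hp t₀ ht₀ _ (hS.subset fun n hn => not_not.1 hn.2)
    exact Ultrafilter.compl_mem_iff_notMem.1 hc hSp
  · obtain ⟨t, htb, ht⟩ := hmeet _ (hflt x)
    obtain ⟨-, y, hy⟩ := (hA.subset _ (hflt x) ht).2.1.2 x rfl
    exact ⟨y, fun U hU hyU => hp t htb _ (hy U hU hyU)⟩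

theorem isPLimit_iff_tendsto {X : Type*} [TopologicalSpace X] {p : Ultrafilter ℕ} {x : ℕ → X}
    {y : X} : IsPLimit p x y ↔ Tendsto x p (nhds y) := by
  rw [tendsto_nhds]
  rfl

theorem PCompact.pi {X : Type*} [TopologicalSpace X] {p : Ultrafilter ℕ} (hX : PCompact X p)
    (ι : Type*) : PCompact (ι → X) p := fun z => by
  choose y hy using fun i => hX fun n => z n i
  exact ⟨y, isPLimit_iff_tendsto.2 (tendsto_pi_nhds.2 fun i => isPLimit_iff_tendsto.1 (hy i))⟩

theorem PCompact.countablyCompact {X : Type*} [TopologicalSpace X] {p : Ultrafilter ℕ}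
    (hX : PCompact X p) (hp : Nonprincipal p) : CountablyCompact X := by
  intro 𝒰 hcount hopen hcover
  rcases 𝒰.eq_empty_or_nonempty with rfl | hne
  · exact ⟨∅, Subset.rfl, finite_empty, hcover⟩
  obtain ⟨U, rfl⟩ := hcount.exists_eq_range hne
  by_contra! hcon
  have hz : ∀ n, ∃ z, ∀ m ≤ n, z ∉ U m := fun n => by
    obtain ⟨z, hz⟩ := (ne_univ_iff_exists_notMem _).1
      (hcon (U '' Iic n) (image_subset_range _ _) ((finite_Iic n).image U))
    exact ⟨z, fun m hm hzm => hz ⟨_, mem_image_of_mem U hm, hzm⟩⟩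
  choose z hz using hz
  obtain ⟨y, hy⟩ := hX z
  obtain ⟨_, ⟨k, rfl⟩, hyk⟩ : y ∈ ⋃₀ range U := hcover ▸ mem_univ y
  refine hp {n | z n ∈ U k} ((finite_lt_nat k).subset fun n hn => ?_)
    (hy _ (hopen _ (mem_range_self k)) hyk)
  exact not_le.1 fun h => hz n k h hn

/-- Under the principle `(*)`, every power of a sequentially compact space of
cardinality at most `𝔠` is countably compact. -/
theorem statement1 (hstar : StarPrinciple) (X : Type) [TopologicalSpace X]
    [SeqCompactSpace X] (hX : Cardinal.mk X ≤ Cardinal.continuum)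
    (ι : Type*) : CountablyCompact (ι → X) := by
  obtain ⟨p, hp, hXp⟩ := hstar.exists_pCompact X hX
  exact (hXp.pi ι).countablyCompact hp
end

section
/- Assume there is a set P of nonprincipal ultrafilters on ℕ of cardinality at most 𝔠 such that every q ∈ P is a P-point having a filter base that is a ⊆*-decreasing ω₁-sequence of infinite subsets of ℕ, and such that for every nonprincipal ultrafilter u on ℕ there exist a finite-to-one f : ℕ → ℕ and q ∈ P with the pushforward of u along f equal to q. Then there exist a separable, sequentially compact Hausdorff topological space X and an index type ι such that the power X^ι with the product topology is not countably compact. -/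
/-- A nonprincipal ultrafilter `p` is a P-point if for every `f : ℕ → ℕ` there is
`A ∈ p` on which `f` is constant or finite-to-one. -/
def IsPPoint (p : Ultrafilter ℕ) : Prop :=
  Nonprincipal p ∧
  ∀ f : ℕ → ℕ, ∃ A ∈ p, (∃ c : ℕ, ∀ n ∈ A, f n = c) ∨ (∀ n : ℕ, (f ⁻¹' {n} ∩ A).Finite)

/-- `p` has a filter base which is a `⊆*`-decreasing `ω₁`-sequence of infinite
subsets of `ℕ`. -/
def HasTowerBase (p : Ultrafilter ℕ) : Prop :=
  ∃ u : {o : Ordinal.{0} // o < (Cardinal.aleph.{0} 1).ord} → Set ℕ,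
    (∀ α, (u α).Infinite) ∧
    (∀ α β, α.1 < β.1 → AlmostSubset (u β) (u α)) ∧
    (∀ A : Set ℕ, A ∈ p ↔ ∃ α, u α ⊆ A)

open Filter Topology Set

section Cells

variable {Y I : Type*}

open Classical in
/-- The map recording which sets of the family `S` contain a given point. -/
noncomputable def membershipMap (S : I → Set Y) (y : Y) (i : I) : Bool := decide (y ∈ S i)

variable [TopologicalSpace Y] {S : I → Set Y}

theorem isClopen_of_isInducing_membershipMap (hS : IsInducing (membershipMap S)) (i : I) :
    IsClopen (S i) := by
  have hc : Continuous fun y => membershipMap S y i := (continuous_apply i).comp hS.continuous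
  have h : S i = (fun y => membershipMap S y i) ⁻¹' {true} := by
    ext y
    simp [membershipMap]
  rw [h]
  exact (isClopen_discrete _).preimage hc

theorem t2Space_of_isInducing_membershipMap (hS : IsInducing (membershipMap S))
    (hsep : ∀ x y, (∀ i, x ∈ S i ↔ y ∈ S i) → x = y) : T2Space Y := by
  refine T2Space.of_injective_continuous (f := membershipMap S) (fun x y hxy => hsep x y fun i => ?_)
    hS.continuous
  simpa [membershipMap] using congrFun hxy i

theorem exists_tendsto_subseq_of_isInducing_membershipMap (hS : IsInducing (membershipMap S))
    {x : ℕ → Y} {y : Y} {B : Set ℕ} (hB : B.Infinite)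
    (h : ∀ i, {k ∈ B | ¬(x k ∈ S i ↔ y ∈ S i)}.Finite) :
    ∃ φ : ℕ → ℕ, StrictMono φ ∧ Tendsto (x ∘ φ) atTop (𝓝 y) := by
  obtain ⟨φ, hφ, hφB⟩ :=
    extraction_of_frequently_atTop (Nat.frequently_atTop_iff_infinite.2 hB)
  refine ⟨φ, hφ, hS.tendsto_nhds_iff.2 (tendsto_pi_nhds.2 fun i => ?_)⟩
  refine tendsto_const_nhds.congr' ?_
  have hfin : ∀ᶠ k in atTop, φ k ∉ {k ∈ B | ¬(x k ∈ S i ↔ y ∈ S i)} :=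
    hφ.tendsto_atTop.eventually (by
      rw [← Nat.cofinite_eq_atTop]
      exact (h i).eventually_cofinite_notMem)
  filter_upwards [hfin] with k hk
  have hiff : x (φ k) ∈ S i ↔ y ∈ S i := by
    by_contra hne
    exact hk ⟨hφB k, hne⟩
  simp [membershipMap, hiff]

end Cells

/-- The points of the space built from a family of towers indexed by `Q`: isolated points,
for each `q : Q` a copy of `Ω`, and a point at infinity. -/
inductive TowerPoint (N Q Ω : Type) : Type
  | isolated (n : N)
  | level (q : Q) (α : Ω)
  | infinity

namespace TowerPoint

variable {N Q Ω : Type} (φ : Q → ℕ → N) (u : Q → Ω → Set ℕ)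

/-- The copy of `ℕ ∪ Ω` belonging to `q`. -/
def block (q : Q) : Set (TowerPoint N Q Ω) := fun
  | isolated n => n ∈ range (φ q)
  | level q' _ => q' = q
  | infinity => False

/-- The initial segment up to `α` of the copy of `Ω` belonging to `q`, together with the
complement of the `α`-th member of the tower. -/
def cylinder [LE Ω] (q : Q) (α : Ω) : Set (TowerPoint N Q Ω) := fun
  | isolated n => n ∈ φ q '' (u q α)ᶜ
  | level q' β => q' = q ∧ β ≤ α
  | infinity => False

/-- The family of clopen sets generating the topology. -/
def cell [LE Ω] : N ⊕ Q ⊕ (Q × Ω) → Set (TowerPoint N Q Ω)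
  | .inl n => {isolated n}
  | .inr (.inl q) => block φ q
  | .inr (.inr (q, α)) => cylinder φ u q α

variable {φ u}

@[simp] theorem isolated_mem_block {q : Q} {n : N} :
    (isolated n : TowerPoint N Q Ω) ∈ block φ q ↔ n ∈ range (φ q) := Iff.rfl

@[simp] theorem level_mem_block {q q' : Q} {α : Ω} : level q' α ∈ block φ q ↔ q' = q := Iff.rfl

@[simp] theorem infinity_notMem_block {q : Q} :
    (infinity : TowerPoint N Q Ω) ∉ block φ q := id

@[simp] theorem isolated_mem_cylinder [LE Ω] {q : Q} {α : Ω} {n : N} :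
    isolated n ∈ cylinder φ u q α ↔ n ∈ φ q '' (u q α)ᶜ := Iff.rfl

@[simp] theorem level_mem_cylinder [LE Ω] {q q' : Q} {α β : Ω} :
    level q' β ∈ cylinder φ u q α ↔ q' = q ∧ β ≤ α := Iff.rfl

@[simp] theorem infinity_notMem_cylinder [LE Ω] {q : Q} {α : Ω} :
    infinity ∉ cylinder φ u q α := id

theorem cylinder_subset_block [LE Ω] (q : Q) (α : Ω) : cylinder φ u q α ⊆ block φ q := by
  rintro (n | ⟨q', β⟩ | _) h
  · exact image_subset_range _ _ h
  · exact h.1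
  · exact h

theorem block_inter_block_finite {q q' : Q}
    (h : (range (φ q) ∩ range (φ q')).Finite) (hne : q ≠ q') :
    (block φ q ∩ block φ q' : Set (TowerPoint N Q Ω)).Finite := by
  refine (h.image isolated).subset ?_
  rintro (n | ⟨q'', β⟩ | _) ⟨h₁, h₂⟩
  · exact ⟨n, ⟨h₁, h₂⟩, rfl⟩
  · exact absurd (h₁.symm.trans h₂) hne
  · exact h₁.elim

theorem cylinder_diff_cylinder_finite [Preorder Ω] {q : Q} {α β : Ω} (hαβ : α ≤ β)
    (h : AlmostSubset (u q β) (u q α)) : (cylinder φ u q α \ cylinder φ u q β).Finite := by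
  refine ((h.image (φ q)).image isolated).subset ?_
  rintro (n | ⟨q', γ⟩ | _) ⟨h₁, h₂⟩
  · obtain ⟨m, hm, rfl⟩ := h₁
    refine ⟨_, ⟨m, ⟨?_, hm⟩, rfl⟩, rfl⟩
    by_contra hmβ
    exact h₂ ⟨m, hmβ, rfl⟩
  · exact absurd ⟨h₁.1, h₁.2.trans hαβ⟩ h₂
  · exact h₁.elim

theorem eq_of_forall_mem_cell_iff [PartialOrder Ω] (x y : TowerPoint N Q Ω)
    (h : ∀ i, x ∈ cell φ u i ↔ y ∈ cell φ u i) : x = y := by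
  cases x with
  | isolated n => exact ((h (.inl n)).1 rfl).symm
  | level q α =>
    cases y with
    | isolated n => exact (h (.inl n)).2 rfl
    | level q' β =>
      obtain rfl : q' = q := (h (.inr (.inl q))).1 rfl
      have h₁ : β ≤ α := ((h (.inr (.inr (q', α)))).1 ⟨rfl, le_rfl⟩).2
      have h₂ : α ≤ β := ((h (.inr (.inr (q', β)))).2 ⟨rfl, le_rfl⟩).2
      rw [h₁.antisymm h₂]
    | infinity => exact ((h (.inr (.inl q))).1 rfl).elim
  | infinity =>
    cases y with
    | isolated n => exact (h (.inl n)).2 rfl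
    | level q α => exact ((h (.inr (.inl q))).2 rfl).elim
    | infinity => rfl

/-- If the towers generate ultrafilters, every infinite part of a block meets some cylinder of
that block in an infinite set. -/
theorem exists_infinite_inter_cylinder [Preorder Ω] {p : Ultrafilter ℕ} {q : Q}
    (hφ : Function.Injective (φ q)) (hu : ∀ A : Set ℕ, A ∈ p → ∃ α, u q α ⊆ A)
    (hΩ : ∀ C : Set Ω, C.Countable → BddAbove C)
    {E : Set (TowerPoint N Q Ω)} (hE : E.Infinite) (hEc : E.Countable) (hEq : E ⊆ block φ q) :
    ∃ α, (E ∩ cylinder φ u q α).Infinite := by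
  have hinj : Function.Injective fun m => (isolated (φ q m) : TowerPoint N Q Ω) :=
    fun a b hab => hφ (by simpa using hab)
  have hlevel : Function.Injective fun α : Ω => (level q α : TowerPoint N Q Ω) :=
    fun a b hab => by simpa using hab
  by_cases hD : ((fun m => (isolated (φ q m) : TowerPoint N Q Ω)) ⁻¹' E).Infinite
  · obtain ⟨D₁, D₂, hunion, hdisj, hcard⟩ := hD.exists_union_disjoint_cardinal_eq_of_infinite
    have hinf : D₁.Infinite ∧ D₂.Infinite := by
      have hiff : D₁.Finite ↔ D₂.Finite := by
        rw [← Cardinal.lt_aleph0_iff_set_finite, ← Cardinal.lt_aleph0_iff_set_finite, hcard]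
      refine ⟨fun h₁ => hD ?_, fun h₂ => hD ?_⟩
      · exact hunion ▸ h₁.union (hiff.1 h₁)
      · exact hunion ▸ (hiff.2 h₂).union h₂
    have key : ∀ D : Set ℕ, D.Infinite → D ⊆ D₁ ∪ D₂ → Dᶜ ∈ p →
        ∃ α, (E ∩ cylinder φ u q α).Infinite := by
      intro D hDinf hsub hDp
      obtain ⟨α, hα⟩ := hu _ hDp
      refine ⟨α, (hDinf.image hinj.injOn).mono ?_⟩
      rintro _ ⟨m, hm, rfl⟩
      have hmE := hsub hm
      rw [hunion] at hmE
      exact ⟨hmE, m, fun hmα => hα hmα hm, rfl⟩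
    by_cases h₁ : D₁ ∈ p
    · refine key D₂ hinf.2 subset_union_right (mem_of_superset h₁ ?_)
      exact fun m hm hm' => hdisj.le_bot ⟨hm, hm'⟩
    · exact key D₁ hinf.1 subset_union_left (Ultrafilter.compl_mem_iff_notMem.2 h₁)
  · rw [not_infinite] at hD
    obtain ⟨α, hα⟩ := hΩ (level q ⁻¹' E) (hEc.preimage hlevel)
    refine ⟨α, (hE.sdiff (hD.image fun m => isolated (φ q m))).mono ?_⟩
    rintro (n | ⟨q', β⟩ | _) ⟨h₁, h₂⟩
    · obtain ⟨m, rfl⟩ := hEq h₁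
      exact absurd ⟨m, h₁, rfl⟩ h₂
    · obtain rfl : q' = q := hEq h₁
      exact ⟨h₁, rfl, hα h₁⟩
    · exact (hEq h₁).elim

theorem exists_tendsto_subseq [LinearOrder Ω] [WellFoundedLT Ω] [TopologicalSpace (TowerPoint N Q Ω)]
    (ht : IsInducing (membershipMap (cell φ u))) {p : Q → Ultrafilter ℕ}
    (hφ : ∀ q, Function.Injective (φ q))
    (had : ∀ q q', q ≠ q' → (range (φ q) ∩ range (φ q')).Finite)
    (hu : ∀ q (A : Set ℕ), A ∈ p q → ∃ α, u q α ⊆ A)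
    (hdec : ∀ q α β, α < β → AlmostSubset (u q β) (u q α))
    (hΩ : ∀ C : Set Ω, C.Countable → BddAbove C) (x : ℕ → TowerPoint N Q Ω) :
    ∃ y, ∃ ψ : ℕ → ℕ, StrictMono ψ ∧ Tendsto (x ∘ ψ) atTop (𝓝 y) := by
  by_cases hconst : ∃ y, (x ⁻¹' {y}).Infinite
  · obtain ⟨y, hy⟩ := hconst
    refine ⟨y, exists_tendsto_subseq_of_isInducing_membershipMap ht hy fun i => ?_⟩
    convert finite_empty (α := ℕ)
    ext k
    simp only [mem_ofPred_eq, mem_empty_iff_false, iff_false]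
    rintro ⟨hk, hne⟩
    exact hne (by rw [show x k = y from hk])
  simp only [not_exists, not_infinite] at hconst
  have hpre : ∀ E : Set (TowerPoint N Q Ω), E.Finite → (x ⁻¹' E).Finite := fun E hE =>
    hE.preimage' fun y _ => hconst y
  by_cases hblock : ∃ q, (x ⁻¹' block φ q).Infinite
  · obtain ⟨q, hq⟩ := hblock
    have hex : ∃ α, (x ⁻¹' cylinder φ u q α).Infinite := by
      have himg : (x '' (x ⁻¹' block φ q)).Infinite := fun hfin =>
        hq ((hpre _ hfin).subset (subset_preimage_image x _))
      obtain ⟨α, hα⟩ := exists_infinite_inter_cylinder (u := u) (hφ q) (hu q) hΩ himg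
        ((to_countable _).image x) (image_preimage_subset _ _)
      refine ⟨α, fun hfin => hα ((hfin.image x).subset ?_)⟩
      rintro _ ⟨⟨k, -, rfl⟩, hk⟩
      exact ⟨k, hk, rfl⟩
    obtain ⟨α, hα, hmin⟩ := WellFounded.has_min (wellFounded_lt (α := Ω))
      {α | (x ⁻¹' cylinder φ u q α).Infinite} hex
    refine ⟨level q α, exists_tendsto_subseq_of_isInducing_membershipMap ht hα ?_⟩
    have hother : ∀ q', q ≠ q' → (x ⁻¹' (block φ q ∩ block φ q')).Finite := fun q' hne =>
      hpre _ (block_inter_block_finite (had q q' hne) hne)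
    rintro (n | q' | ⟨q', β⟩)
    · refine (hpre {isolated n} (finite_singleton _)).subset ?_
      rintro k ⟨-, hk⟩
      simpa [cell] using hk
    · rcases eq_or_ne q q' with rfl | hne
      · convert finite_empty (α := ℕ)
        ext k
        simp only [mem_ofPred_eq, mem_empty_iff_false, iff_false]
        rintro ⟨hk, hk'⟩
        exact hk' (iff_of_true (cylinder_subset_block _ _ hk) rfl)
      · refine (hother q' hne).subset ?_
        rintro k ⟨hk, hk'⟩
        exact ⟨cylinder_subset_block _ _ hk, by simpa [cell, hne] using hk'⟩
    · rcases eq_or_ne q q' with rfl | hne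
      · rcases le_or_gt α β with hαβ | hβα
        · have hfin : (cylinder φ u q α \ cylinder φ u q β).Finite := by
            rcases hαβ.eq_or_lt with rfl | hlt
            · simp
            · exact cylinder_diff_cylinder_finite hαβ (hdec q α β hlt)
          refine (hpre _ hfin).subset ?_
          rintro k ⟨hk, hk'⟩
          exact ⟨hk, by simpa [cell, hαβ] using hk'⟩
        · refine (not_infinite.1 fun hβ => hmin β hβ hβα).subset ?_
          rintro k ⟨-, hk⟩
          simpa [cell, hβα.not_ge] using hk
      · refine (hother q' hne).subset ?_
        rintro k ⟨hk, hk'⟩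
        refine ⟨cylinder_subset_block _ _ hk, cylinder_subset_block (u := u) _ β ?_⟩
        simpa [cell, hne] using hk'
  · simp only [not_exists, not_infinite] at hblock
    refine ⟨infinity, exists_tendsto_subseq_of_isInducing_membershipMap ht infinite_univ ?_⟩
    rintro (n | q | ⟨q, β⟩)
    · refine (hpre {isolated n} (finite_singleton _)).subset ?_
      rintro k ⟨-, hk⟩
      simpa [cell] using hk
    · refine (hblock q).subset ?_
      rintro k ⟨-, hk⟩
      simpa [cell] using hk
    · refine (hblock q).subset ?_
      rintro k ⟨-, hk⟩
      exact cylinder_subset_block (u := u) _ β (by simpa [cell] using hk)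

theorem not_isPLimit [Preorder Ω] [TopologicalSpace (TowerPoint N Q Ω)]
    (ht : IsInducing (membershipMap (cell φ u))) {p : Ultrafilter ℕ} {q : Q}
    (hp : Nonprincipal p) (hφ : Function.Injective (φ q)) (hu : ∀ α, u q α ∈ p)
    (y : TowerPoint N Q Ω) : ¬IsPLimit p (fun m => isolated (φ q m)) y := by
  intro hy
  have hclopen := isClopen_of_isInducing_membershipMap ht
  cases y with
  | isolated n =>
    refine hp _ ?_ (hy {isolated n} (hclopen (.inl n)).isOpen rfl)
    refine Set.Subsingleton.finite fun a ha b hb => hφ ?_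
    simp only [mem_ofPred_eq, mem_singleton_iff, isolated.injEq] at ha hb
    rw [ha, hb]
  | level q' α =>
    rcases eq_or_ne q' q with rfl | hne
    · have h := hy (cylinder φ u q' α) (hclopen (.inr (.inr (q', α)))).isOpen ⟨rfl, le_rfl⟩
      refine p.empty_notMem (mem_of_superset (inter_mem h (hu α)) ?_)
      rintro m ⟨⟨m', hm', heq⟩, hm⟩
      exact hm' (hφ heq ▸ hm)
    · have h := hy (block φ q)ᶜ (hclopen (.inr (.inl q))).compl.isOpen hne
      exact p.empty_notMem (mem_of_superset h fun m hm => hm ⟨m, rfl⟩)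
  | infinity =>
    have h := hy (block φ q)ᶜ (hclopen (.inr (.inl q))).compl.isOpen id
    exact p.empty_notMem (mem_of_superset h fun m hm => hm ⟨m, rfl⟩)

end TowerPoint

theorem CountablyCompact.exists_mapClusterPt {X : Type*} [TopologicalSpace X]
    (h : CountablyCompact X) (z : ℕ → X) : ∃ y, MapClusterPt y atTop z := by
  by_contra! hne
  let U : ℕ → Set X := fun n => (closure (z '' Ici n))ᶜ
  have hmono : Monotone U := fun a b hab =>
    compl_subset_compl.2 (closure_mono (image_mono (Ici_subset_Ici.2 hab)))
  obtain ⟨𝒱, hsub, hfin, hcov⟩ := h (range U) (countable_range U)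
    (by rintro _ ⟨n, rfl⟩; exact isClosed_closure.isOpen_compl) (by
      refine eq_univ_of_forall fun y => ?_
      have hy := hne y
      rw [mapClusterPt_atTop_iff_forall_mem_closure] at hy
      push Not at hy
      obtain ⟨n, hn⟩ := hy
      exact ⟨U n, ⟨n, rfl⟩, hn⟩)
  have hindex : ∀ V ∈ 𝒱, ∃ n, U n = V := fun V hV => hsub hV
  choose! g hg using hindex
  obtain ⟨n, hn⟩ := (hfin.image g).bddAbove
  obtain ⟨V, hV, hzV⟩ : z n ∈ ⋃₀ 𝒱 := hcov ▸ mem_univ _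
  rw [← hg V hV] at hzV
  exact hmono (hn ⟨V, hV, rfl⟩) hzV (subset_closure ⟨n, self_mem_Ici, rfl⟩)

theorem CountablyCompact.exists_isPLimit {X : Type*} [TopologicalSpace X]
    (h : CountablyCompact X) (z : ℕ → X) : ∃ p, Nonprincipal p ∧ ∃ y, IsPLimit p z y := by
  obtain ⟨y, hy⟩ := h.exists_mapClusterPt z
  obtain ⟨p, hp, hlim⟩ := mapClusterPt_iff_ultrafilter.1 hy
  refine ⟨p, fun A hA hAp => ?_, y, fun U hU hyU => hlim (hU.mem_nhds hyU)⟩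
  have hAc : Aᶜ ∈ p := hp (by
    rw [← Nat.cofinite_eq_atTop]
    exact hA.compl_mem_cofinite)
  exact Ultrafilter.compl_mem_iff_notMem.1 hAc hAp

theorem IsPLimit.comp_continuous {X Z : Type*} [TopologicalSpace X] [TopologicalSpace Z]
    {p : Ultrafilter ℕ} {x : ℕ → X} {y : X} (h : IsPLimit p x y) {g : X → Z} (hg : Continuous g) :
    IsPLimit p (g ∘ x) (g y) :=
  fun _ hU hy => h _ (hU.preimage hg) hy

theorem IsPLimit.map {X : Type*} [TopologicalSpace X] {p : Ultrafilter ℕ} {x : ℕ → X} {y : X}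
    {f : ℕ → ℕ} (h : IsPLimit p (x ∘ f) y) : IsPLimit (p.map f) x y :=
  fun U hU hy => h U hU hy

/-- The finite initial segments of a branch, viewed as a sequence of nodes of the binary tree. -/
def branchNode (r : ℕ → Bool) (m : ℕ) : List Bool := (List.range m).map r

theorem branchNode_injective (r : ℕ → Bool) : Function.Injective (branchNode r) := fun a b h => by
  simpa [branchNode] using congrArg List.length h

theorem range_branchNode_inter_finite {r s : ℕ → Bool} (h : r ≠ s) :
    (range (branchNode r) ∩ range (branchNode s)).Finite := by
  obtain ⟨i, hi⟩ := Function.ne_iff.1 h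
  refine ((finite_Iic i).image (branchNode r)).subset ?_
  rintro _ ⟨⟨m, rfl⟩, m', hm'⟩
  obtain rfl : m' = m := by simpa [branchNode] using congrArg List.length hm'
  refine ⟨m', ?_, rfl⟩
  by_contra! hlt
  simp only [mem_Iic, not_le] at hlt
  exact hi ((List.map_inj_left.1 hm') i (List.mem_range.2 hlt)).symm

theorem bddAbove_of_countable_aleph_one {C : Set (Cardinal.aleph.{0} 1).ord.ToType}
    (hC : C.Countable) : BddAbove C := by
  have := hC.to_subtype
  have hlt : ⨆ c : C, (Ordinal.ToType.toOrd c.1).1 < (Cardinal.aleph.{0} 1).ord := by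
    refine (Ordinal.iSup_lt_omega_one fun c => ?_).trans_eq (Cardinal.ord_aleph 1).symm
    exact (Ordinal.ToType.toOrd c.1).2.trans_eq (Cardinal.ord_aleph 1)
  refine ⟨Ordinal.ToType.mk ⟨_, hlt⟩, fun c hc => ?_⟩
  rw [← Ordinal.ToType.mk.symm_apply_le]
  exact Ordinal.le_iSup (fun c : C => (Ordinal.ToType.toOrd c.1).1) ⟨c, hc⟩

/-- Under the stated NCF-type hypothesis (true in the Miller model), there is a
separable, sequentially compact Hausdorff space with a power that is not
countably compact. -/
theorem statement10 (P : Set (Ultrafilter ℕ))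
    (hsmall : Cardinal.mk P ≤ Cardinal.continuum)
    (hP : ∀ q ∈ P, Nonprincipal q ∧ IsPPoint q ∧ HasTowerBase q)
    (hcof : ∀ u : Ultrafilter ℕ, Nonprincipal u →
      ∃ f : ℕ → ℕ, FiniteToOne f ∧ ∃ q ∈ P, Ultrafilter.map f u = q) :
    ∃ (X : Type) (t : TopologicalSpace X),
      @T2Space X t ∧ @TopologicalSpace.SeparableSpace X t ∧ @SeqCompactSpace X t ∧
      ∃ ι : Type, ¬ @CountablyCompact (ι → X)
        (@Pi.topologicalSpace ι (fun _ => X) (fun _ => t)) := by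
  classical
  choose u huinf hudec hubase using fun q : P => (hP q q.2).2.2
  obtain ⟨r, hr⟩ : ∃ r : P → ℕ → Bool, Function.Injective r := by
    have hle : Cardinal.mk P ≤ Cardinal.mk (ℕ → Bool) := by simpa using hsmall
    exact ⟨_, hle.some.injective⟩
  let Ω : Type := (Cardinal.aleph.{0} 1).ord.ToType
  let φ : P → ℕ → List Bool := fun q => branchNode (r q)
  let v : P → Ω → Set ℕ := fun q α => u q (Ordinal.ToType.toOrd α)
  let Y : Type := TowerPoint (List Bool) P Ω
  let _ : TopologicalSpace Y :=
    TopologicalSpace.induced (membershipMap (TowerPoint.cell φ v)) inferInstance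
  have ht : IsInducing (membershipMap (TowerPoint.cell φ v)) := ⟨rfl⟩
  have hφ : ∀ q, Function.Injective (φ q) := fun q => branchNode_injective _
  have hvmem : ∀ q α, v q α ∈ q.1 := fun q α => (hubase q _).2 ⟨_, Subset.rfl⟩
  let e : List Bool → Y := TowerPoint.isolated
  let X : Type := closure (range e)
  let e' : List Bool → X := fun n => ⟨e n, subset_closure ⟨n, rfl⟩⟩
  have : T2Space Y :=
    t2Space_of_isInducing_membershipMap ht TowerPoint.eq_of_forall_mem_cell_iff
  refine ⟨X, inferInstance, inferInstance, ⟨range e', countable_range _, ?_⟩, ⟨?_⟩,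
    P × (ℕ → ℕ), fun hcc => ?_⟩
  · refine IsInducing.subtypeVal.dense_iff.2 fun x => ?_
    rw [← range_comp]
    exact x.2
  · intro x _
    obtain ⟨y, ψ, hψ, hlim⟩ := TowerPoint.exists_tendsto_subseq ht (p := fun q => q.1) hφ
      (fun q q' hne => range_branchNode_inter_finite (hr.ne hne))
      (fun q A hA => by
        obtain ⟨α, hα⟩ := (hubase q A).1 hA
        exact ⟨Ordinal.ToType.mk α,
          (congrArg (u q) (Ordinal.ToType.mk.symm_apply_apply α)).trans_subset hα⟩)
      (fun q α β hαβ => hudec q _ _ (Ordinal.ToType.mk.symm.lt_iff_lt.2 hαβ))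
      (fun C hC => bddAbove_of_countable_aleph_one hC) (fun k => (x k).1)
    have hy : y ∈ closure (range e) :=
      isClosed_closure.mem_of_tendsto hlim (Eventually.of_forall fun k => (x (ψ k)).2)
    exact ⟨⟨y, hy⟩, mem_univ _, ψ, hψ, tendsto_subtype_rng.2 hlim⟩
  · obtain ⟨p, hp, y, hy⟩ :=
      hcc.exists_isPLimit fun n (i : P × (ℕ → ℕ)) => e' (φ i.1 (i.2 n))
    obtain ⟨f, -, q, hq, hfq⟩ := hcof p hp
    have hlim : IsPLimit (p.map f) (fun m => e (φ ⟨q, hq⟩ m)) (y (⟨q, hq⟩, f)).1 :=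
      IsPLimit.map (hy.comp_continuous
        (g := fun w : P × (ℕ → ℕ) → X => (w (⟨q, hq⟩, f)).1)
        (continuous_subtype_val.comp (continuous_apply _)))
    rw [hfq] at hlim
    exact TowerPoint.not_isPLimit ht (hP q hq).1 (hφ ⟨q, hq⟩) (hvmem ⟨q, hq⟩) _ hlim
end
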